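/- arXiv:0704.2377 — 3 statements merged into one kernel-verified Lean document; each statement's English description precedes it below -/
import Mathlib

section
/- Let d, n, m, α be positive integers such that d is even, m ≥ 2, α² ≤ d, m(m−1) − 2 ≤ n²·d, and n·d < m·α. Then n²·d = m(m−1) − 2 and n·α = m − 1. -/
theorem stmt_0 (d n m α : ℤ) (hd : 0 < d) (hn : 0 < n) (hm : 0 < m) (hα : 0 < α)
    (hdeven : Even d) (hm2 : 2 ≤ m) (hαd : α ^ 2 ≤ d)
    (hgen : m * (m - 1) - 2 ≤ n ^ 2 * d) (hses : n * d < m * α) :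
    n ^ 2 * d = m * (m - 1) - 2 ∧ n * α = m - 1 := by
  have hnα : n * α < m := by
    have h : n * α ^ 2 ≤ n * d := mul_le_mul_of_nonneg_left hαd hn.le
    exact lt_of_mul_lt_mul_right (by linarith [h] : n * α * α < m * α) hα.le
  have hlt : n ^ 2 * d < m * (n * α) := by
    have h := mul_lt_mul_of_pos_left hses hn
    linarith
  have hle : m * (n * α) ≤ m * (m - 1) := mul_le_mul_of_nonneg_left (by omega) hm.le
  have heq : n ^ 2 * d = m * (m - 1) - 2 := by
    obtain ⟨a, ha⟩ := hdeven.mul_left (n ^ 2)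
    obtain ⟨b, hb⟩ := Int.even_mul_pred_self m
    omega
  refine ⟨heq, ?_⟩
  by_contra hne
  have h : m * (n * α) ≤ m * (m - 2) := mul_le_mul_of_nonneg_left (by omega) hm.le
  linarith
end

section
/- Let d, n, m, α be positive integers such that d is even, m ≥ 2, α² ≤ d, m(m−1) − 2 ≤ n²·d, and n·d < m·α. Then n divides 2, i.e. n = 1 or n = 2. -/
theorem stmt_1 (d n m α : ℤ) (hd : 0 < d) (hn : 0 < n) (hm : 0 < m) (hα : 0 < α)
    (hdeven : Even d) (hm2 : 2 ≤ m) (hαd : α ^ 2 ≤ d)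
    (hgen : m * (m - 1) - 2 ≤ n ^ 2 * d) (hses : n * d < m * α) :
    n ∣ 2 ∧ (n = 1 ∨ n = 2) := by
  have h_lt : n * α < m := by
    refine lt_of_mul_lt_mul_right ?_ hα.le
    calc n * α * α = n * α ^ 2 := by ring
      _ ≤ n * d := by gcongr
      _ < m * α := hses
  have h_upper : n ^ 2 * d ≤ m * (m - 1) - n :=
    calc n ^ 2 * d = n * (n * d) := by ring
      _ ≤ n * (m * α - 1) := by gcongr; omega
      _ = m * (n * α) - n := by ring
      _ ≤ m * (m - 1) - n := by gcongr; omega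
  have h_cases : n = 1 ∨ n = 2 := by omega
  refine ⟨?_, h_cases⟩
  rcases h_cases with rfl | rfl <;> norm_num
end

section
/- Let d, n, m, α be positive integers such that d is even, m ≥ 2, α² ≤ d, m(m−1) − 2 ≤ n²·d, and n·d < m·α. Then exactly one of the following holds: (i) n = 1, m = α + 1, d = α² + α − 2, and (n·d : ℚ)/m = α − 2/(α+1); or (ii) n = 2, m = 2α + 1, 2·d = 2α² + α − 1, and (n·d : ℚ)/m = α − 1/(2α+1). -/
theorem stmt_2 (d n m α : ℤ) (hd : 0 < d) (hn : 0 < n) (hm : 0 < m) (hα : 0 < α)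
    (hdeven : Even d) (hm2 : 2 ≤ m) (hαd : α ^ 2 ≤ d)
    (hgen : m * (m - 1) - 2 ≤ n ^ 2 * d) (hses : n * d < m * α) :
    Xor'
      (n = 1 ∧ m = α + 1 ∧ d = α ^ 2 + α - 2 ∧
        ((n * d : ℤ) : ℚ) / (m : ℚ) = (α : ℚ) - 2 / ((α : ℚ) + 1))
      (n = 2 ∧ m = 2 * α + 1 ∧ 2 * d = 2 * α ^ 2 + α - 1 ∧
        ((n * d : ℤ) : ℚ) / (m : ℚ) = (α : ℚ) - 1 / (2 * (α : ℚ) + 1)) := by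
  have hlow : n * α < m := by
    have : (n * α) * α < m * α := by nlinarith
    exact lt_of_mul_lt_mul_right this hα.le
  have hkey : m * (m - 1 - n * α) ≤ 2 - n := by nlinarith
  have hmeq : m = n * α + 1 := by
    by_contra hne
    have hk : 1 ≤ m - 1 - n * α := by omega
    nlinarith
  have hn2 : n ≤ 2 := by
    have : m - 1 - n * α = 0 := by omega
    rw [this] at hkey
    linarith
  have hαQ : (0 : ℚ) < α := by exact_mod_cast hα
  subst hmeq
  obtain rfl | rfl : n = 1 ∨ n = 2 := by omega
  · refine Or.inl ⟨?_, fun h => by omega⟩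
    have hd_eq : d = α ^ 2 + α - 2 := by
      have h₁ : α * (α + 1) - 2 ≤ d := by linarith
      have h₂ : d < α * (α + 1) := by linarith
      have h₃ := hdeven.two_dvd
      have h₄ := (Int.even_mul_succ_self α).two_dvd
      have h₅ : α ^ 2 + α = α * (α + 1) := by ring
      omega
    refine ⟨rfl, by ring, hd_eq, ?_⟩
    rw [hd_eq]
    push_cast
    field_simp
  · refine Or.inr ⟨?_, fun h => by omega⟩
    have hd_eq : 2 * d = 2 * α ^ 2 + α - 1 := by
      have h₁ : 2 * (2 * α ^ 2 + α - 1) ≤ 2 * (2 * d) := by linarith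
      have h₂ : 2 * d < 2 * α ^ 2 + α := by linarith
      omega
    refine ⟨rfl, rfl, hd_eq, ?_⟩
    rw [hd_eq]
    push_cast
    field_simp
end
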